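/- For any positive integer n and any ξ ∈ F_q((T^{-1})) which is not algebraic of degree at most n, if w_n(ξ) = n then w_n^*(ξ) = n. -/

import Mathlib

open Polynomial
open scoped Classical

namespace MahlerKoksmaFq

noncomputable section

variable (Fq : Type) [Field Fq] [Fintype Fq]

/-- `K Fq` models `F_q((T⁻¹))`: Laurent series in the variable `t = T⁻¹`. -/
abbrev K := LaurentSeries Fq

/-- The element `T` (the inverse of the Laurent-series variable `t = T⁻¹`). -/
def Tvar : K Fq := HahnSeries.single (-1 : ℤ) 1

/-- The absolute value `|ξ| = q^{-ν(ξ)}` on `F_q((T⁻¹))`. -/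
def absK (ξ : K Fq) : ℝ :=
  if ξ = 0 then 0 else (Fintype.card Fq : ℝ) ^ (-(HahnSeries.order ξ))

/-- The embedding of `F_q[T]` into `F_q((T⁻¹))`, sending `T` to `Tvar`. -/
def emb : Polynomial Fq →+* K Fq :=
  Polynomial.eval₂RingHom (algebraMap Fq (K Fq)) (Tvar Fq)

/-- Evaluation of `P ∈ F_q[T][X]` at `ξ ∈ F_q((T⁻¹))`. -/
def evalK (P : Polynomial (Polynomial Fq)) (ξ : K Fq) : K Fq :=
  P.eval₂ (emb Fq) ξ

/-- Height of a polynomial over `F_q[T]`: the maximum of the absolute values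
`q^{deg c}` of its coefficients. -/
def HP (P : Polynomial (Polynomial Fq)) : ℝ :=
  (Fintype.card Fq : ℝ) ^ (P.support.sup fun i => (P.coeff i).natDegree)

/-- `ξ` is algebraic (over `F_q[T]`) of degree at most `n`. -/
def IsAlgDegLe (ξ : K Fq) (n : ℕ) : Prop :=
  ∃ P : Polynomial (Polynomial Fq), P ≠ 0 ∧ P.natDegree ≤ n ∧ evalK Fq P ξ = 0

/-- `ξ` is algebraic over `F_q[T]`. -/
def IsAlgK (ξ : K Fq) : Prop :=
  ∃ P : Polynomial (Polynomial Fq), P ≠ 0 ∧ evalK Fq P ξ = 0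

/-- The degree of an algebraic element of `F_q((T⁻¹))`. -/
def degA (α : K Fq) : ℕ :=
  sInf {d | ∃ P : Polynomial (Polynomial Fq), P ≠ 0 ∧ P.natDegree = d ∧ evalK Fq P α = 0}

/-- The height of an algebraic element `α` of `F_q((T⁻¹))`: the least height of a
 nonzero annihilating polynomial of minimal degree (= height of the minimal
 defining polynomial over `F_q[T]`). -/
def HA (α : K Fq) : ℝ :=
  sInf {h | ∃ P : Polynomial (Polynomial Fq),
    P ≠ 0 ∧ P.natDegree = degA Fq α ∧ evalK Fq P α = 0 ∧ h = HP Fq P}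

/-- The defining set for Mahler's exponent `w_n`. -/
def wnSet (ξ : K Fq) (n : ℕ) : Set ℝ :=
  {w | {P : Polynomial (Polynomial Fq) |
      P.natDegree ≤ n ∧ 0 < absK Fq (evalK Fq P ξ) ∧
      absK Fq (evalK Fq P ξ) < HP Fq P ^ (-w)}.Infinite}

/-- Mahler's exponent `w_n(ξ)`. -/
def wn (ξ : K Fq) (n : ℕ) : EReal :=
  sSup ((fun w : ℝ => (w : EReal)) '' wnSet Fq ξ n)

/-- The defining set for `w_n^{sep}` (separable polynomials only). -/
def wnsepSet (ξ : K Fq) (n : ℕ) : Set ℝ :=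
  {w | {P : Polynomial (Polynomial Fq) |
      P.Separable ∧ P.natDegree ≤ n ∧ 0 < absK Fq (evalK Fq P ξ) ∧
      absK Fq (evalK Fq P ξ) < HP Fq P ^ (-w)}.Infinite}

/-- The exponent `w_n^{sep}(ξ)`. -/
def wnsep (ξ : K Fq) (n : ℕ) : EReal :=
  sSup ((fun w : ℝ => (w : EReal)) '' wnsepSet Fq ξ n)

/-- The defining set for Koksma's exponent `w_n^*` (approximation by algebraic
elements lying in `F_q((T⁻¹))`). -/
def wnstarSet (ξ : K Fq) (n : ℕ) : Set ℝ :=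
  {w | {α : K Fq | IsAlgK Fq α ∧ degA Fq α ≤ n ∧ 0 < absK Fq (ξ - α) ∧
      absK Fq (ξ - α) < HA Fq α ^ (-w - 1)}.Infinite}

/-- Koksma's exponent `w_n^*(ξ)`. -/
def wnstar (ξ : K Fq) (n : ℕ) : EReal :=
  sSup ((fun w : ℝ => (w : EReal)) '' wnstarSet Fq ξ n)

/-- The defining set for the uniform exponent `ŵ_n`. -/
def hwnSet (ξ : K Fq) (n : ℕ) : Set ℝ :=
  {w | ∃ H0 : ℝ, ∀ H : ℝ, H0 < H → ∃ P : Polynomial (Polynomial Fq),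
      P.natDegree ≤ n ∧ HP Fq P ≤ H ∧ 0 < absK Fq (evalK Fq P ξ) ∧
      absK Fq (evalK Fq P ξ) < H ^ (-w)}

/-- The uniform exponent `ŵ_n(ξ)`. -/
def hwn (ξ : K Fq) (n : ℕ) : EReal :=
  sSup ((fun w : ℝ => (w : EReal)) '' hwnSet Fq ξ n)

/-- The defining set for the uniform exponent `ŵ_n^{sep}` (separable polynomials only). -/
def hwnsepSet (ξ : K Fq) (n : ℕ) : Set ℝ :=
  {w | ∃ H0 : ℝ, ∀ H : ℝ, H0 < H → ∃ P : Polynomial (Polynomial Fq),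
      P.Separable ∧ P.natDegree ≤ n ∧ HP Fq P ≤ H ∧ 0 < absK Fq (evalK Fq P ξ) ∧
      absK Fq (evalK Fq P ξ) < H ^ (-w)}

/-- The uniform exponent `ŵ_n^{sep}(ξ)`. -/
def hwnsep (ξ : K Fq) (n : ℕ) : EReal :=
  sSup ((fun w : ℝ => (w : EReal)) '' hwnsepSet Fq ξ n)

/-- The fractional part of a Laurent series in `T⁻¹`: the part with only
 negative powers of `T` (positive powers of the series variable `t = T⁻¹`). -/
def fracPart (η : K Fq) : K Fq :=
  { coeff := fun m => if 0 < m then η.coeff m else 0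
    isPWO_support' := η.isPWO_support'.mono (fun m hm => by
      by_cases h : 0 < m
      · simpa [Function.mem_support, h] using hm
      · simp [Function.mem_support, h] at hm) }

/-- The fractional-part norm `‖η‖ = |η - [η]|`. -/
def fracNorm (η : K Fq) : ℝ := absK Fq (fracPart Fq η)

/-- `max{‖R(T)ξ‖, …, ‖R(T)ξⁿ‖}`. -/
def maxFrac (ξ : K Fq) (n : ℕ) (R : Polynomial Fq) : ℝ :=
  sSup ((fun i => fracNorm Fq (emb Fq R * ξ ^ i)) '' Set.Icc 1 n)

/-- The defining set for the exponent of simultaneous approximation `λ_n`. -/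
def lamSet (ξ : K Fq) (n : ℕ) : Set ℝ :=
  {l | {R : Polynomial Fq | 0 < maxFrac Fq ξ n R ∧
      maxFrac Fq ξ n R < (Fintype.card Fq : ℝ) ^ (-(l * R.natDegree))}.Infinite}

/-- The exponent of simultaneous approximation `λ_n(ξ)`. -/
def lam (ξ : K Fq) (n : ℕ) : EReal :=
  sSup ((fun w : ℝ => (w : EReal)) '' lamSet Fq ξ n)

/-- The defining set for the uniform exponent `λ̂_n`. -/
def hlamSet (ξ : K Fq) (n : ℕ) : Set ℝ :=
  {l | ∃ d0 : ℕ, ∀ d : ℕ, d0 < d → ∃ R : Polynomial Fq, R.natDegree ≤ d ∧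
      0 < maxFrac Fq ξ n R ∧
      maxFrac Fq ξ n R < (Fintype.card Fq : ℝ) ^ (-(l * d))}

/-- The uniform exponent `λ̂_n(ξ)`. -/
def hlam (ξ : K Fq) (n : ℕ) : EReal :=
  sSup ((fun w : ℝ => (w : EReal)) '' hlamSet Fq ξ n)

/-- An algebraic closure of `F_q((T⁻¹))`; its algebraic elements are exactly the
algebraic elements of the completion `C_∞`. -/
abbrev Kbar := AlgebraicClosure (K Fq)

/-- The embedding of `F_q[T]` into the algebraic closure. -/
def embbar : Polynomial Fq →+* Kbar Fq :=
  (algebraMap (K Fq) (Kbar Fq)).comp (emb Fq)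

/-- Evaluation of `P ∈ F_q[T][X]` at a point of the algebraic closure. -/
def evalKbar (P : Polynomial (Polynomial Fq)) (x : Kbar Fq) : Kbar Fq :=
  P.eval₂ (embbar Fq) x

/-- The unique extension of the absolute value of `F_q((T⁻¹))` to its algebraic
closure: `|x| = |N(x)|^{1/d} = |a_0|^{1/d}` where `a_0` is the constant term and
`d` the degree of the minimal polynomial of `x` over `F_q((T⁻¹))`. -/
def absC (x : Kbar Fq) : ℝ :=
  absK Fq ((minpoly (K Fq) x).coeff 0) ^ ((1 : ℝ) / (minpoly (K Fq) x).natDegree)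

/-- `x ∈ C_∞` is algebraic over `F_q[T]`. -/
def IsAlgKbar (x : Kbar Fq) : Prop :=
  ∃ P : Polynomial (Polynomial Fq), P ≠ 0 ∧ evalKbar Fq P x = 0

/-- Degree over `F_q[T]` of an algebraic element of `C_∞`. -/
def degAbar (x : Kbar Fq) : ℕ :=
  sInf {d | ∃ P : Polynomial (Polynomial Fq), P ≠ 0 ∧ P.natDegree = d ∧ evalKbar Fq P x = 0}

/-- Height of an algebraic element of `C_∞`. -/
def HAbar (x : Kbar Fq) : ℝ :=
  sInf {h | ∃ P : Polynomial (Polynomial Fq),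
    P ≠ 0 ∧ P.natDegree = degAbar Fq x ∧ evalKbar Fq P x = 0 ∧ h = HP Fq P}

/-- The defining set for the exponent `w_n^@` (approximation by algebraic
elements of `C_∞`). -/
def wnAtSet (ξ : K Fq) (n : ℕ) : Set ℝ :=
  {w | {α : Kbar Fq | IsAlgKbar Fq α ∧ degAbar Fq α ≤ n ∧
      0 < absC Fq (algebraMap (K Fq) (Kbar Fq) ξ - α) ∧
      absC Fq (algebraMap (K Fq) (Kbar Fq) ξ - α) < HAbar Fq α ^ (-w - 1)}.Infinite}

/-- The exponent `w_n^@(ξ)`. -/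
def wnAt (ξ : K Fq) (n : ℕ) : EReal :=
  sSup ((fun w : ℝ => (w : EReal)) '' wnAtSet Fq ξ n)

/-- The defining set for the uniform exponent `ŵ_n^@`. -/
def hwnAtSet (ξ : K Fq) (n : ℕ) : Set ℝ :=
  {w | ∃ H0 : ℝ, ∀ H : ℝ, H0 < H → ∃ α : Kbar Fq, IsAlgKbar Fq α ∧ degAbar Fq α ≤ n ∧
      HAbar Fq α ≤ H ∧ 0 < absC Fq (algebraMap (K Fq) (Kbar Fq) ξ - α) ∧
      absC Fq (algebraMap (K Fq) (Kbar Fq) ξ - α) < (HAbar Fq α)⁻¹ * H ^ (-w)}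

/-- The uniform exponent `ŵ_n^@(ξ)`. -/
def hwnAt (ξ : K Fq) (n : ℕ) : EReal :=
  sSup ((fun w : ℝ => (w : EReal)) '' hwnAtSet Fq ξ n)

/-- `w(ξ) = limsup_n w_n(ξ)/n`. -/
def wlim (ξ : K Fq) : EReal :=
  Filter.atTop.limsup fun n : ℕ => wn Fq ξ n * (((n : ℝ)⁻¹ : ℝ) : EReal)

/-- `w^*(ξ) = limsup_n w_n^*(ξ)/n`. -/
def wlimstar (ξ : K Fq) : EReal :=
  Filter.atTop.limsup fun n : ℕ => wnstar Fq ξ n * (((n : ℝ)⁻¹ : ℝ) : EReal)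

/-- Height of a polynomial over `C_∞`: maximum of the absolute values of its
coefficients. -/
def HC (P : Polynomial (Kbar Fq)) : ℝ :=
  sSup ((fun i => absC Fq (P.coeff i)) '' Set.Iic P.natDegree)


section aux
variable {Fq : Type} [Field Fq]

/-- `x` has order at least `m`. -/
def Bd (x : K Fq) (m : ℤ) : Prop := (m : WithTop ℤ) ≤ x.orderTop

lemma bd_iff {x : K Fq} {m : ℤ} : Bd x m ↔ ∀ i : ℤ, i < m → x.coeff i = 0 := by
  unfold Bd
  rw [HahnSeries.le_orderTop_iff_forall]
  constructor
  · intro h i hi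
    exact h i (by exact_mod_cast hi)
  · intro h i hi
    exact h i (by exact_mod_cast hi)

lemma bd_iff_order {x : K Fq} (hx : x ≠ 0) {m : ℤ} : Bd x m ↔ m ≤ x.order := by
  unfold Bd
  rw [← HahnSeries.order_eq_orderTop_of_ne_zero hx]
  exact WithTop.coe_le_coe

lemma Bd.mono {x : K Fq} {m k : ℤ} (h : Bd x m) (hk : k ≤ m) : Bd x k :=
  le_trans (by exact_mod_cast hk) h

lemma bd_zero (m : ℤ) : Bd (0 : K Fq) m := by
  simp [Bd]

lemma bd_one : Bd (1 : K Fq) 0 := by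
  simp [Bd]

lemma Bd.add {x y : K Fq} {m : ℤ} (hx : Bd x m) (hy : Bd y m) : Bd (x + y) m :=
  le_trans (le_min hx hy) HahnSeries.min_orderTop_le_orderTop_add

lemma Bd.neg {x : K Fq} {m : ℤ} (hx : Bd x m) : Bd (-x) m := by
  unfold Bd; rwa [HahnSeries.orderTop_neg]

lemma Bd.sub {x y : K Fq} {m : ℤ} (hx : Bd x m) (hy : Bd y m) : Bd (x - y) m := by
  rw [sub_eq_add_neg]; exact hx.add hy.neg

lemma Bd.mul {x y : K Fq} {m k : ℤ} (hx : Bd x m) (hy : Bd y k) : Bd (x * y) (m + k) := by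
  unfold Bd
  rw [HahnSeries.orderTop_mul, WithTop.coe_add]
  exact add_le_add hx hy

lemma Bd.pow {x : K Fq} {m : ℤ} (hx : Bd x m) (i : ℕ) : Bd (x ^ i) (i * m) := by
  induction i with
  | zero => simpa using bd_one
  | succ i ih =>
    rw [pow_succ]
    exact (ih.mul hx).mono (by push_cast; linarith)

lemma bd_sum {ι : Type*} (s : Finset ι) (f : ι → K Fq) (m : ℤ) (h : ∀ i ∈ s, Bd (f i) m) :
    Bd (∑ i ∈ s, f i) m := by
  induction s using Finset.induction_on with
  | empty => simpa using bd_zero m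
  | insert a s ha ih =>
    rw [Finset.sum_insert ha]
    exact (h a (Finset.mem_insert_self _ _)).add
      (ih fun i hi => h i (Finset.mem_insert_of_mem hi))

lemma bd_natCast (k : ℕ) : Bd ((k : ℕ) : K Fq) 0 := by
  induction k with
  | zero => simpa using bd_zero 0
  | succ k ih => push_cast; exact ih.add bd_one

lemma Tvar_pow (j : ℕ) : Tvar Fq ^ j = HahnSeries.single (-(j : ℤ)) 1 := by
  unfold Tvar
  rw [HahnSeries.single_pow]
  simp

lemma algMap_eq (a : Fq) : algebraMap Fq (K Fq) a = HahnSeries.single 0 a := by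
  rw [HahnSeries.algebraMap_apply']
  exact HahnSeries.ofPowerSeries_C a

lemma emb_coeff (p : Polynomial Fq) (j : ℤ) :
    (emb Fq p).coeff (-j) = if 0 ≤ j then p.coeff j.toNat else 0 := by
  unfold emb
  rw [Polynomial.coe_eval₂RingHom]
  induction p using Polynomial.induction_on' with
  | add p q hp hq =>
    rw [Polynomial.eval₂_add, HahnSeries.coeff_add, hp, hq]
    split_ifs <;> simp
  | monomial i a =>
    rw [Polynomial.eval₂_monomial, Tvar_pow, algMap_eq, HahnSeries.coeff_single_zero_mul,
      HahnSeries.coeff_single, Polynomial.coeff_monomial]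
    by_cases h : 0 ≤ j
    · have : (-j = -(i:ℤ)) ↔ i = j.toNat := by omega
      simp [h]
      grind
    · have : ¬ (-j = -(i:ℤ)) := by omega
      simp [h]; intro h'; omega

lemma bd_emb_iff (p : Polynomial Fq) (d : ℕ) : Bd (emb Fq p) (-d) ↔ p.natDegree ≤ d := by
  rw [bd_iff, Polynomial.natDegree_le_iff_coeff_eq_zero]
  constructor
  · intro h j hj
    have := h (-j) (by omega)
    rw [emb_coeff] at this
    simpa using this
  · intro h i hi
    have := emb_coeff p (-i)
    rw [neg_neg] at this
    rw [this]
    split_ifs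
    · exact h _ (by omega)
    · rfl

lemma emb_inj : Function.Injective (emb Fq) := by
  rw [injective_iff_map_eq_zero]
  intro p hp
  ext j
  have := emb_coeff p j
  rw [hp] at this
  simpa using this.symm

end aux
section hensel
variable {F : Type} [Field F]

lemma hensel_aux (n : ℕ) (hn : 1 ≤ n) (d : ℕ → PowerSeries F) (hd : ∀ k, PowerSeries.X ∣ d k) :
    ∃ y : PowerSeries F, 1 + y + ∑ k ∈ Finset.Icc 2 n, d k * y ^ k = 0 := by
  set I : Ideal (PowerSeries F) := Ideal.span {PowerSeries.X} with hI
  have hdI : ∀ k, d k ∈ I := fun k => Ideal.mem_span_singleton.2 (hd k)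
  set g : Polynomial (PowerSeries F) :=
    ∑ k ∈ Finset.Icc 2 n, Polynomial.C (d k) * Polynomial.X ^ (n - k) with hg
  set f : Polynomial (PowerSeries F) :=
    Polynomial.X ^ n + (Polynomial.X ^ (n - 1) + g) with hf
  have hgd : (Polynomial.X ^ (n - 1) + g).degree < (n : WithBot ℕ) := by
    refine lt_of_le_of_lt (Polynomial.degree_add_le _ _) (max_lt ?_ ?_)
    · rw [Polynomial.degree_X_pow]; exact_mod_cast (by omega : n - 1 < n)
    · refine lt_of_le_of_lt (Polynomial.degree_sum_le _ _) ?_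
      rw [Finset.sup_lt_iff (by exact_mod_cast WithBot.bot_lt_coe n)]
      intro k hk
      rw [Finset.mem_Icc] at hk
      refine lt_of_le_of_lt (Polynomial.degree_C_mul_X_pow_le _ _) ?_
      exact_mod_cast (by omega : n - k < n)
  have hmon : f.Monic := Polynomial.monic_X_pow_add hgd
  have hgI : ∀ z : PowerSeries F, g.eval z ∈ I := by
    intro z
    rw [hg, Polynomial.eval_finsetSum]
    refine Ideal.sum_mem _ fun k _ => ?_
    simp only [Polynomial.eval_mul, Polynomial.eval_C]
    exact I.mul_mem_right _ (hdI k)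
  have hgI' : ∀ z : PowerSeries F, g.derivative.eval z ∈ I := by
    intro z
    rw [hg, Polynomial.derivative_sum, Polynomial.eval_finsetSum]
    refine Ideal.sum_mem _ fun k _ => ?_
    rw [Polynomial.derivative_C_mul]
    simp only [Polynomial.eval_mul, Polynomial.eval_C]
    exact I.mul_mem_right _ (hdI k)
  have hfe : f = Polynomial.X ^ (n - 1) * (Polynomial.X + 1) + g := by
    rw [hf]
    obtain ⟨m, rfl⟩ : ∃ m, n = m + 1 := ⟨n - 1, by omega⟩
    simp only [Nat.add_sub_cancel]
    ring
  have h1 : f.eval (-1) ∈ I := by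
    rw [hfe]
    simpa using hgI (-1)
  have h2 : IsUnit (Ideal.Quotient.mk I (f.derivative.eval (-1))) := by
    have : f.derivative.eval (-1) = (-1) ^ (n - 1) + g.derivative.eval (-1) := by
      rw [hfe]
      simp
    rw [this, map_add, Ideal.Quotient.eq_zero_iff_mem.2 (hgI' _), add_zero]
    apply IsUnit.map
    exact IsUnit.pow _ (isUnit_one.neg)
  obtain ⟨z, hz, hz1⟩ := (inferInstance : HenselianRing (PowerSeries F) I).is_henselian f hmon (-1) h1 h2
  have hzu : IsUnit z := by
    rw [PowerSeries.isUnit_iff_constantCoeff]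
    rw [hI, Ideal.mem_span_singleton, PowerSeries.X_dvd_iff] at hz1
    rw [map_sub, map_neg, map_one, sub_neg_eq_add] at hz1
    rw [eq_neg_of_add_eq_zero_left hz1]
    exact isUnit_one.neg
  obtain ⟨y, hy⟩ := hzu.exists_right_inv
  refine ⟨y, ?_⟩
  have hz0 : f.eval z = 0 := hz
  have key : ∀ k ≤ n, z ^ (n - k) * y ^ n = y ^ k := by
    intro k hk
    obtain ⟨m, rfl⟩ := Nat.exists_eq_add_of_le hk
    rw [Nat.add_sub_cancel_left, pow_add, mul_comm (y ^ k), ← mul_assoc, ← mul_pow, hy]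
    simp
  have h3 : f.eval z * y ^ n = 0 := by rw [hz0, zero_mul]
  rw [hf, hg] at h3
  simp only [Polynomial.eval_add, Polynomial.eval_pow, Polynomial.eval_X,
    Polynomial.eval_finsetSum, Polynomial.eval_mul, Polynomial.eval_C, add_mul,
    Finset.sum_mul] at h3
  rw [key 1 hn, pow_one] at h3
  have h0 := key 0 (Nat.zero_le _)
  rw [Nat.sub_zero, pow_zero] at h0
  rw [h0] at h3
  rw [← h3, add_assoc]
  congr 2
  refine Finset.sum_congr rfl fun k hk => ?_
  rw [Finset.mem_Icc] at hk
  rw [mul_assoc, key k hk.2]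

lemma exists_ps (x : K F) (h : Bd x 0) : ∃ y : PowerSeries F, HahnSeries.ofPowerSeries ℤ F y = x := by
  refine ⟨PowerSeries.mk fun i => x.coeff i, ?_⟩
  ext i
  rw [PowerSeries.coeff_coe]
  split_ifs with hi
  · rw [bd_iff.1 h i hi]
  · rw [PowerSeries.coeff_mk]
    congr 1
    omega

lemma bd_ofPS (y : PowerSeries F) : Bd (HahnSeries.ofPowerSeries ℤ F y) 0 := by
  rw [bd_iff]
  intro i hi
  rw [PowerSeries.coeff_coe, if_pos hi]

/-- Newton/Hensel step in `F((t))`. -/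
lemma hensel_K (n : ℕ) (hn : 1 ≤ n) (d : ℕ → K F) (hd : ∀ k ∈ Finset.Icc 2 n, Bd (d k) 1) :
    ∃ y : K F, Bd y 0 ∧ 1 + y + ∑ k ∈ Finset.Icc 2 n, d k * y ^ k = 0 := by
  have : ∀ k, ∃ e : PowerSeries F, PowerSeries.X ∣ e ∧
      (k ∈ Finset.Icc 2 n → HahnSeries.ofPowerSeries ℤ F e = d k) := by
    intro k
    by_cases hk : k ∈ Finset.Icc 2 n
    · obtain ⟨e, he⟩ := exists_ps (d k) ((hd k hk).mono (by norm_num))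
      refine ⟨e, ?_, fun _ => he⟩
      rw [PowerSeries.X_dvd_iff, ← PowerSeries.coeff_zero_eq_constantCoeff_apply]
      have h0 := bd_iff.1 (hd k hk) 0 (by norm_num)
      rw [← he, PowerSeries.coeff_coe] at h0
      simpa using h0
    · exact ⟨0, dvd_zero _, fun h => absurd h hk⟩
  choose e he1 he2 using this
  obtain ⟨y, hy⟩ := hensel_aux n hn e he1
  refine ⟨HahnSeries.ofPowerSeries ℤ F y, bd_ofPS y, ?_⟩
  have := congrArg (HahnSeries.ofPowerSeries ℤ F) hy
  simp only [map_add, map_one, map_sum, map_mul, map_pow, map_zero] at this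
  rw [← this]
  congr 1
  refine Finset.sum_congr rfl fun k hk => ?_
  rw [he2 k hk]

end hensel
section heights
variable {Fq : Type} [Field Fq]

/-- logarithmic height -/
def hgt (P : Polynomial (Polynomial Fq)) : ℕ := P.support.sup fun i => (P.coeff i).natDegree

lemma hgt_le_iff (P : Polynomial (Polynomial Fq)) (j : ℕ) :
    hgt P ≤ j ↔ ∀ i, (P.coeff i).natDegree ≤ j := by
  unfold hgt
  rw [Finset.sup_le_iff]
  constructor
  · intro h i
    by_cases hi : i ∈ P.support
    · exact h i hi
    · rw [Polynomial.notMem_support_iff.1 hi]; simp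
  · intro h i _
    exact h i

lemma HP_eq [Fintype Fq] (P : Polynomial (Polynomial Fq)) :
    HP Fq P = (Fintype.card Fq : ℝ) ^ hgt P := rfl

lemma swap_coeff_coeff (P : Polynomial (Polynomial Fq)) (i j : ℕ) :
    ((Polynomial.Bivariate.swap P).coeff j).coeff i = (P.coeff i).coeff j := by
  induction P using Polynomial.induction_on' with
  | add p q hp hq => simp [hp, hq]
  | monomial k a =>
    induction a using Polynomial.induction_on' with
    | add p q hp hq => simp only [map_add, Polynomial.coeff_add, hp, hq]
    | monomial l b =>
      rw [Polynomial.Bivariate.swap_monomial_monomial]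
      simp only [Polynomial.coeff_monomial]
      split_ifs <;> simp_all [Polynomial.coeff_monomial]

lemma natDegree_swap (P : Polynomial (Polynomial Fq)) :
    (Polynomial.Bivariate.swap P).natDegree = hgt P := by
  refine eq_of_forall_ge_iff fun d => ?_
  rw [hgt_le_iff, Polynomial.natDegree_le_iff_coeff_eq_zero]
  simp only [Polynomial.natDegree_le_iff_coeff_eq_zero]
  constructor
  · intro h i N hN
    rw [← swap_coeff_coeff, h N hN, Polynomial.coeff_zero]
  · intro h N hN
    ext i
    rw [swap_coeff_coeff, h i N hN, Polynomial.coeff_zero]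

lemma hgt_le_of_dvd {p P : Polynomial (Polynomial Fq)} (h : p ∣ P) (hP : P ≠ 0) :
    hgt p ≤ hgt P := by
  obtain ⟨r, rfl⟩ := h
  have hinj := (Polynomial.Bivariate.swap (R := Fq)).injective
  have hm : Polynomial.Bivariate.swap (p * r) =
      Polynomial.Bivariate.swap p * Polynomial.Bivariate.swap r := map_mul _ _ _
  have hp : Polynomial.Bivariate.swap p ≠ 0 := fun h0 =>
    hP (by rw [hinj (h0.trans (map_zero _).symm), zero_mul])
  have hr : Polynomial.Bivariate.swap r ≠ 0 := fun h0 =>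
    hP (by rw [hinj (h0.trans (map_zero _).symm), mul_zero])
  rw [← natDegree_swap, ← natDegree_swap, hm, Polynomial.natDegree_mul hp hr]
  exact Nat.le_add_right _ _

lemma evalK_eq (P : Polynomial (Polynomial Fq)) (x : K Fq) :
    evalK Fq P x = (P.map (emb Fq)).eval x := by
  rw [Polynomial.eval_map]; rfl

lemma evalK_mul (P Q : Polynomial (Polynomial Fq)) (x : K Fq) :
    evalK Fq (P * Q) x = evalK Fq P x * evalK Fq Q x := Polynomial.eval₂_mul _ _

lemma evalK_sub (P Q : Polynomial (Polynomial Fq)) (x : K Fq) :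
    evalK Fq (P - Q) x = evalK Fq P x - evalK Fq Q x := Polynomial.eval₂_sub _

lemma degA_le {α : K Fq} {P : Polynomial (Polynomial Fq)} (hP : P ≠ 0)
    (h : evalK Fq P α = 0) : degA Fq α ≤ P.natDegree :=
  Nat.sInf_le ⟨P, hP, rfl, h⟩

lemma exists_prim {α : K Fq} (hα : IsAlgK Fq α) : ∃ p : Polynomial (Polynomial Fq),
    p ≠ 0 ∧ p.natDegree = degA Fq α ∧ evalK Fq p α = 0 ∧ p.IsPrimitive := by
  obtain ⟨P, hP, hPα⟩ := hα
  obtain ⟨p, hp, hpd, hpα⟩ : degA Fq α ∈ {d | ∃ P : Polynomial (Polynomial Fq),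
      P ≠ 0 ∧ P.natDegree = d ∧ evalK Fq P α = 0} := Nat.sInf_mem ⟨_, P, hP, rfl, hPα⟩
  let _ : NormalizedGCDMonoid (Polynomial Fq) :=
    Classical.choice (inferInstance : Nonempty (NormalizedGCDMonoid (Polynomial Fq)))
  refine ⟨p.primPart, p.primPart_ne_zero, by rw [p.natDegree_primPart, hpd], ?_,
    p.isPrimitive_primPart⟩
  rw [p.eq_C_content_mul_primPart, evalK_mul] at hpα
  rcases mul_eq_zero.1 hpα with h | h
  · exfalso
    unfold evalK at h
    rw [Polynomial.eval₂_C] at h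
    have := (map_eq_zero_iff _ emb_inj).1 h
    rw [Polynomial.content_eq_zero_iff] at this
    exact hp this
  · exact h

lemma prim_dvd {α : K Fq} {p P : Polynomial (Polynomial Fq)} (hp : p ≠ 0)
    (hpd : p.natDegree = degA Fq α) (hpα : evalK Fq p α = 0) (hprim : p.IsPrimitive)
    (hPα : evalK Fq P α = 0) : p ∣ P := by
  let L := FractionRing (Polynomial Fq)
  apply hprim.dvd_of_fraction_map_dvd_fraction_map (K := L)
  let φ : L →+* K Fq := IsFractionRing.lift (emb_inj (Fq := Fq))
  have hφ : φ.comp (algebraMap (Polynomial Fq) L) = emb Fq := by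
    refine RingHom.ext fun a => ?_
    simp [φ]
  have hev : ∀ Q : Polynomial (Polynomial Fq),
      (Q.map (algebraMap _ L)).eval₂ φ α = evalK Fq Q α := by
    intro Q
    rw [Polynomial.eval₂_map, hφ]; rfl
  set pL := p.map (algebraMap _ L) with hpL
  set PL := P.map (algebraMap _ L) with hPL
  have hinj : Function.Injective (algebraMap (Polynomial Fq) L) := IsFractionRing.injective _ _
  have hpL0 : pL ≠ 0 := by
    rw [hpL, Ne, Polynomial.map_eq_zero_iff hinj]; exact hp
  rw [← EuclideanDomain.mod_eq_zero]
  by_contra hr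
  set r := PL % pL with hr_def
  have hrα : r.eval₂ φ α = 0 := by
    have h1 := EuclideanDomain.div_add_mod PL pL
    have h2 := congrArg (Polynomial.eval₂ φ α) h1
    rw [Polynomial.eval₂_add, Polynomial.eval₂_mul, hev p, hpα, hev P, hPα, zero_mul,
      zero_add] at h2
    exact h2
  have hdeg : r.natDegree < pL.natDegree := by
    apply Polynomial.natDegree_lt_natDegree hr
    exact EuclideanDomain.mod_lt PL hpL0
  set r' := IsLocalization.integerNormalization (nonZeroDivisors (Polynomial Fq)) r with hr'
  obtain ⟨b, hbm, hb⟩ := IsLocalization.integerNormalization_spec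
    (nonZeroDivisors (Polynomial Fq)) r
  rw [← hr'] at hb
  have hr'α : evalK Fq r' α = 0 := by
    have := IsLocalization.integerNormalization_eval₂_eq_zero
      (nonZeroDivisors (Polynomial Fq)) φ r hrα
    rw [hφ] at this
    exact this
  have hb0 : b ≠ 0 := nonZeroDivisors.ne_zero hbm
  have hr'0 : r' ≠ 0 := by
    intro h0
    rw [h0, Polynomial.map_zero] at hb
    rcases smul_eq_zero.1 hb.symm with h | h
    · exact hb0 h
    · exact hr h
  have h1 := degA_le hr'0 hr'α
  have h2 : r'.natDegree ≤ r.natDegree := by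
    rw [← Polynomial.natDegree_map_eq_of_injective hinj r', hb]
    exact Polynomial.natDegree_smul_le _ _
  rw [hpL, Polynomial.natDegree_map_eq_of_injective hinj] at hdeg
  omega

lemma exists_HA [Fintype Fq] {α : K Fq} (hα : IsAlgK Fq α) :
    ∃ p : Polynomial (Polynomial Fq), p ≠ 0 ∧ p.natDegree = degA Fq α ∧ evalK Fq p α = 0 ∧
      HA Fq α = HP Fq p ∧ ∀ P : Polynomial (Polynomial Fq), P ≠ 0 → evalK Fq P α = 0 →
        hgt p ≤ hgt P := by
  have hex : ∃ j, ∃ p : Polynomial (Polynomial Fq), p ≠ 0 ∧ p.natDegree = degA Fq α ∧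
      evalK Fq p α = 0 ∧ hgt p = j := by
    obtain ⟨p, h1, h2, h3, _⟩ := exists_prim hα
    exact ⟨_, p, h1, h2, h3, rfl⟩
  obtain ⟨p, h1, h2, h3, h4⟩ := Nat.find_spec hex
  have hmin : ∀ p' : Polynomial (Polynomial Fq), p' ≠ 0 → p'.natDegree = degA Fq α →
      evalK Fq p' α = 0 → hgt p ≤ hgt p' := by
    intro p' a b c
    rw [h4]
    exact Nat.find_min' hex ⟨p', a, b, c, rfl⟩
  refine ⟨p, h1, h2, h3, ?_, ?_⟩
  · refine IsLeast.csInf_eq ⟨⟨p, h1, h2, h3, rfl⟩, ?_⟩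
    rintro _ ⟨p', a, b, c, rfl⟩
    rw [HP_eq, HP_eq]
    refine pow_le_pow_right₀ ?_ (hmin p' a b c)
    exact_mod_cast Fintype.card_pos
  · intro P hP hPα
    obtain ⟨p', a, b, c, d⟩ := exists_prim hα
    exact (hmin p' a b c).trans (hgt_le_of_dvd (prim_dvd a b c d hPα) hP)

/-- Taylor coefficients at `ξ`. -/
def tc (P : Polynomial (Polynomial Fq)) (ξ : K Fq) (k : ℕ) : K Fq :=
  (Polynomial.taylor ξ (P.map (emb Fq))).coeff k

lemma tc_eq {P : Polynomial (Polynomial Fq)} {n : ℕ} (hP : P.natDegree ≤ n) (ξ : K Fq) (k : ℕ) :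
    tc P ξ k = ∑ i ∈ Finset.range (n + 1),
      emb Fq (P.coeff i) * (ξ ^ (i - k) * ((i.choose k : ℕ) : K Fq)) := by
  unfold tc
  have h := (P.map (emb Fq)).as_sum_range' (n + 1)
    (lt_of_le_of_lt (Polynomial.natDegree_map_le) (by omega))
  conv_lhs => rw [h]
  rw [map_sum, Polynomial.finsetSum_coeff]
  refine Finset.sum_congr rfl fun i _ => ?_
  rw [Polynomial.taylor_monomial, Polynomial.coeff_C_mul, Polynomial.coeff_X_add_C_pow,
    Polynomial.coeff_map]

lemma tc_zero (P : Polynomial (Polynomial Fq)) (ξ : K Fq) : tc P ξ 0 = evalK Fq P ξ := by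
  rw [evalK_eq, tc, Polynomial.taylor_coeff_zero]

lemma eval_add {P : Polynomial (Polynomial Fq)} {n : ℕ} (hP : P.natDegree ≤ n) (ξ δ : K Fq) :
    evalK Fq P (ξ + δ) = ∑ k ∈ Finset.range (n + 1), tc P ξ k * δ ^ k := by
  rw [evalK_eq, add_comm, ← Polynomial.taylor_eval, Polynomial.eval_eq_sum_range' (n := n + 1)]
  · rfl
  · rw [Polynomial.natDegree_taylor]
    exact lt_of_le_of_lt (Polynomial.natDegree_map_le) (by omega)

lemma tc_term_bd {a : Polynomial Fq} {n e i k j : ℕ} {ξ : K Fq} (hξ : Bd ξ (-(e : ℤ)))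
    (hi : i ≤ n) (ha : a.natDegree ≤ j) :
    Bd (emb Fq a * (ξ ^ (i - k) * ((i.choose k : ℕ) : K Fq))) (-((j : ℤ) + n * e)) := by
  have h1 := ((bd_emb_iff a j).2 ha).mul ((hξ.pow (i - k)).mul (bd_natCast (i.choose k)))
  refine h1.mono ?_
  have : ((i - k : ℕ) : ℤ) * e ≤ n * e := by
    have : (i - k) * e ≤ n * e := Nat.mul_le_mul_right _ (by omega)
    exact_mod_cast this
  linarith

lemma tc_bd {P : Polynomial (Polynomial Fq)} {n e j : ℕ} {ξ : K Fq} (hξ : Bd ξ (-(e : ℤ)))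
    (hP : P.natDegree ≤ n) (hj : hgt P ≤ j) (k : ℕ) : Bd (tc P ξ k) (-((j : ℤ) + n * e)) := by
  rw [tc_eq hP]
  refine bd_sum _ _ _ fun i hi => ?_
  rw [Finset.mem_range] at hi
  exact tc_term_bd hξ (by omega) ((hgt_le_iff P j).1 hj i)

lemma pigeon [Fintype Fq] (n N : ℕ) (d : ℕ → ℕ) (M : ℤ) (ξ : K Fq)
    (hM : ∀ P : Polynomial (Polynomial Fq), P.natDegree ≤ n →
      (∀ i, (P.coeff i).natDegree ≤ d i) → Bd (evalK Fq P ξ) M)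
    (hN : N < ∑ i ∈ Finset.range (n + 1), (d i + 1)) :
    ∃ P : Polynomial (Polynomial Fq), P ≠ 0 ∧ P.natDegree ≤ n ∧
      (∀ i, (P.coeff i).natDegree ≤ d i) ∧ Bd (evalK Fq P ξ) (M + N) := by
  let V := (i : Fin (n + 1)) → Fin (d i + 1) → Fq
  let p : V → Polynomial (Polynomial Fq) := fun f =>
    Polynomial.ofFn (n + 1) fun i => Polynomial.ofFn (d i + 1) (f i)
  have hp1 : ∀ f, (p f).natDegree ≤ n := fun f =>
    Nat.lt_succ_iff.1 (Polynomial.ofFn_natDegree_lt (by omega) _)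
  have hp2 : ∀ f i, ((p f).coeff i).natDegree ≤ d i := by
    intro f i
    by_cases hi : i < n + 1
    · simp only [p]
      rw [Polynomial.ofFn_coeff_eq_val_of_lt _ hi]
      exact Nat.lt_succ_iff.1 (Polynomial.ofFn_natDegree_lt (by omega) _)
    · simp only [p]
      rw [Polynomial.ofFn_coeff_eq_zero_of_ge _ (by omega)]
      simp
  have hpinj : Function.Injective p := by
    intro f g hfg
    have h1 := Polynomial.injective_ofFn _ hfg
    funext i
    exact Polynomial.injective_ofFn _ (congrFun h1 i)
  let D : V → (Fin N → Fq) := fun f k => (evalK Fq (p f) ξ).coeff (M + (k : ℕ))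
  have hcard : Fintype.card (Fin N → Fq) < Fintype.card V := by
    have h1 : Fintype.card V = Fintype.card Fq ^ ∑ i ∈ Finset.range (n + 1), (d i + 1) := by
      simp only [V]
      rw [Fintype.card_pi, ← Fin.sum_univ_eq_sum_range (fun i => d i + 1),
        ← Finset.prod_pow_eq_pow_sum]
      simp
    rw [h1, Fintype.card_fun, Fintype.card_fin]
    exact Nat.pow_lt_pow_right Fintype.one_lt_card hN
  obtain ⟨f, g, hne, hD⟩ := Fintype.exists_ne_map_eq_of_card_lt D hcard
  have a1 : (p f - p g).natDegree ≤ n :=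
    (Polynomial.natDegree_sub_le _ _).trans (max_le (hp1 f) (hp1 g))
  have a2 : ∀ i, ((p f - p g).coeff i).natDegree ≤ d i := by
    intro i
    rw [Polynomial.coeff_sub]
    exact (Polynomial.natDegree_sub_le _ _).trans (max_le (hp2 f i) (hp2 g i))
  refine ⟨p f - p g, sub_ne_zero.2 fun h => hne (hpinj h), a1, a2, ?_⟩
  rw [bd_iff]
  intro i hi
  by_cases hiM : i < M
  · exact bd_iff.1 (hM _ a1 a2) i hiM
  · have hk : (i - M).toNat < N := by omega
    have := congrFun hD ⟨(i - M).toNat, hk⟩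
    simp only [D] at this
    have hi' : M + ((i - M).toNat : ℤ) = i := by omega
    rw [hi'] at this
    rw [evalK_sub, HahnSeries.coeff_sub, this, sub_self]

end heights
section mainpart
variable {Fq : Type} [Field Fq]

lemma inf_of {X : Type*} (S : Set X) (f : X → K Fq) (h0 : ∀ x ∈ S, f x ≠ 0)
    (h : ∀ M : ℕ, ∃ x ∈ S, Bd (f x) M) : S.Infinite := by
  intro hS
  obtain ⟨B, hB⟩ := (hS.image fun x => (f x).order).bddAbove
  obtain ⟨x, hx, hb⟩ := h (B.toNat + 1)
  rw [bd_iff_order (h0 x hx)] at hb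
  have := hB (Set.mem_image_of_mem _ hx)
  push_cast at hb
  omega

lemma exists_e (ξ : K Fq) : ∃ e : ℕ, Bd ξ (-(e : ℤ)) := by
  by_cases h : ξ = 0
  · exact ⟨0, h ▸ bd_zero _⟩
  · refine ⟨ξ.order.natAbs, ?_⟩
    rw [bd_iff_order h]; omega

lemma absK_pos [Fintype Fq] {x : K Fq} : 0 < absK Fq x ↔ x ≠ 0 := by
  unfold absK
  have : (0 : ℝ) < Fintype.card Fq := by exact_mod_cast Fintype.card_pos
  split_ifs with h
  · simp [h]
  · simp only [ne_eq, h, not_false_eq_true, iff_true]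
    positivity

lemma absK_lt_iff [Fintype Fq] {x : K Fq} (hx : x ≠ 0) (j : ℕ) (w : ℝ) :
    absK Fq x < ((Fintype.card Fq : ℝ) ^ j) ^ (-w) ↔ w * j < (x.order : ℝ) := by
  unfold absK
  rw [if_neg hx]
  have h1 : (1 : ℝ) < Fintype.card Fq := by exact_mod_cast Fintype.one_lt_card
  rw [← Real.rpow_natCast, ← Real.rpow_mul (by linarith), ← Real.rpow_intCast,
    Real.rpow_lt_rpow_left_iff h1]
  push_cast
  constructor <;> intro h <;> nlinarith

lemma dichotomy [Fintype Fq] (m L s e : ℕ) (ξ : K Fq) (hξ : Bd ξ (-(e : ℤ))) :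
    ∃ P : Polynomial (Polynomial Fq), P ≠ 0 ∧ P.natDegree ≤ m + 1 ∧ hgt P ≤ (L + 1) * s ∧
      Bd (evalK Fq P ξ) ((m + 1) * L * s + s - (m + 1) * e) ∧
      (Bd (tc P ξ 1) (-((L : ℤ) * s)) → hgt P ≤ L * s + 2 * ((m + 1) * e)) := by
  obtain ⟨P, hP0, hPn, hPd, hPB⟩ := pigeon (m + 1) (2 * (L + 1) * s + m * L * s)
    (fun i => if i ≤ 1 then (L + 1) * s else L * s) (-(((L + 1) * s : ℕ) + ((m + 1 : ℕ) : ℤ) * e)) ξ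
    (by
      intro P h1 h2
      rw [← tc_zero]
      refine tc_bd hξ h1 ?_ 0
      rw [hgt_le_iff]
      intro i
      refine (h2 i).trans ?_
      split_ifs
      · exact le_rfl
      · exact Nat.mul_le_mul_right _ (by omega))
    (by
      rw [Finset.sum_range_succ', Finset.sum_range_succ']
      simp
      nlinarith)
  have hPB' : Bd (evalK Fq P ξ) ((m + 1) * L * s + s - (m + 1) * e) := by
    refine hPB.mono (le_of_eq ?_)
    push_cast; ring
  have hge2 : ∀ i, (P.coeff (i + 2)).natDegree ≤ L * s := by
    intro i
    have := hPd (i + 2)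
    simpa using this
  refine ⟨P, hP0, hPn, ?_, hPB', ?_⟩
  · rw [hgt_le_iff]
    intro i
    refine (hPd i).trans ?_
    split_ifs
    · exact le_rfl
    · exact Nat.mul_le_mul_right _ (by omega)
  · intro hb
    have ha1 : (P.coeff 1).natDegree ≤ L * s + (m + 1) * e := by
      rw [← bd_emb_iff]
      have h := tc_eq hPn ξ 1
      rw [Finset.sum_range_succ', Finset.sum_range_succ'] at h
      simp only [zero_add, Nat.sub_self, pow_zero, Nat.choose_self, Nat.cast_one, mul_one,
        Nat.choose_zero_succ, Nat.cast_zero, mul_zero, add_zero] at h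
      have h' := sub_eq_of_eq_add' h
      rw [← h']
      refine Bd.sub (hb.mono ?_) (bd_sum _ _ _ fun i hi => ?_)
      · push_cast; nlinarith
      · rw [Finset.mem_range] at hi
        refine (tc_term_bd (n := m + 1) hξ (by omega) (hge2 i)).mono (le_of_eq ?_)
        push_cast; ring
    have ha0 : (P.coeff 0).natDegree ≤ L * s + 2 * ((m + 1) * e) := by
      rw [← bd_emb_iff]
      have h := tc_eq hPn ξ 0
      rw [Finset.sum_range_succ', tc_zero] at h
      simp only [Nat.choose_self, Nat.cast_one, mul_one, Nat.sub_zero, pow_zero] at h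
      have h' := sub_eq_of_eq_add' h
      rw [← h']
      refine Bd.sub (hPB'.mono ?_) (bd_sum _ _ _ fun i hi => ?_)
      · push_cast
        have : (0 : ℤ) ≤ (m + 1) * L * s := by positivity
        have : (0 : ℤ) ≤ (m + 1) * e := by positivity
        have : (0 : ℤ) ≤ L * s := by positivity
        linarith
      · rw [Finset.mem_range] at hi
        have hj : (P.coeff (i + 1)).natDegree ≤ L * s + (m + 1) * e := by
          rcases i with _ | i
          · exact ha1
          · exact (hge2 i).trans (Nat.le_add_right _ _)
        have := tc_term_bd (n := m + 1) (k := 0) hξ (by omega : i + 1 ≤ m + 1) hj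
        refine this.mono (le_of_eq ?_)
        push_cast; ring
    rw [hgt_le_iff]
    intro i
    rcases i with _ | _ | i
    · exact ha0
    · refine ha1.trans ?_
      have : 0 ≤ (m + 1) * e := Nat.zero_le _
      omega
    · exact (hge2 i).trans (Nat.le_add_right _ _)

/-- The Newton step. -/
lemma newton {n : ℕ} (hn : 1 ≤ n) {P : Polynomial (Polynomial Fq)} (hP : P.natDegree ≤ n)
    {ξ : K Fq} (A B C : ℤ) (hA : Bd (evalK Fq P ξ) A) (hB : ¬ Bd (tc P ξ 1) (-B))
    (hC : ∀ k, Bd (tc P ξ k) (-C)) (hA0 : 0 ≤ A) (hB0 : 0 ≤ B) (h1 : 1 ≤ 2 * B + A - C) :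
    ∃ δ : K Fq, Bd δ (A + B) ∧ evalK Fq P (ξ + δ) = 0 := by
  set a := evalK Fq P ξ with ha
  set b := tc P ξ 1 with hb
  have hb0 : b ≠ 0 := fun h => hB (h ▸ bd_zero _)
  have hbi : Bd b⁻¹ B := by
    rw [bd_iff_order hb0] at hB
    rw [bd_iff_order (inv_ne_zero hb0)]
    have h : (b * b⁻¹).order = b.order + b⁻¹.order :=
      HahnSeries.order_mul hb0 (inv_ne_zero hb0)
    rw [mul_inv_cancel₀ hb0, HahnSeries.order_one] at h
    omega
  obtain ⟨y, hy0, hy⟩ := hensel_K n hn (fun k => tc P ξ k * a ^ (k - 1) * b⁻¹ ^ k) (by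
    intro k hk
    rw [Finset.mem_Icc] at hk
    refine (((hC k).mul (hA.pow (k - 1))).mul (hbi.pow k)).mono ?_
    have e1 : A ≤ ((k - 1 : ℕ) : ℤ) * A := by
      have : (1 : ℤ) ≤ ((k - 1 : ℕ) : ℤ) := by exact_mod_cast (by omega : 1 ≤ k - 1)
      nlinarith
    have e2 : 2 * B ≤ (k : ℤ) * B := by
      have : (2 : ℤ) ≤ (k : ℤ) := by exact_mod_cast hk.1
      nlinarith
    linarith)
  refine ⟨a * b⁻¹ * y, ?_, ?_⟩
  · exact ((hA.mul hbi).mul hy0).mono (by linarith)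
  · rw [eval_add hP]
    have hr : Finset.range (n + 1) = insert 0 (insert 1 (Finset.Icc 2 n)) := by
      ext k; simp; omega
    rw [hr, Finset.sum_insert (by simp), Finset.sum_insert (by simp), tc_zero, ← ha, ← hb]
    have : a * (1 + y + ∑ k ∈ Finset.Icc 2 n, tc P ξ k * a ^ (k - 1) * b⁻¹ ^ k * y ^ k) = 0 := by
      rw [hy, mul_zero]
    rw [← this, mul_add, Finset.mul_sum, ← add_assoc]
    congr 1
    · field_simp
    · refine Finset.sum_congr rfl fun k hk => ?_
      rw [Finset.mem_Icc] at hk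
      obtain ⟨l, rfl⟩ : ∃ l, k = l + 1 := ⟨k - 1, by omega⟩
      simp only [Nat.add_sub_cancel, mul_pow]
      ring

lemma finite_bdd [Fintype Fq] (n J : ℕ) :
    {P : Polynomial (Polynomial Fq) | P.natDegree ≤ n ∧ hgt P ≤ J}.Finite := by
  refine (Set.finite_range (fun f : Fin (n + 1) → Fin (J + 1) → Fq =>
    Polynomial.ofFn (n + 1) fun i => Polynomial.ofFn (J + 1) (f i))).subset ?_
  rintro P ⟨h1, h2⟩
  refine ⟨fun i j => (P.coeff i).coeff j, ?_⟩
  ext i j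
  simp only
  by_cases hi : i < n + 1
  · rw [Polynomial.ofFn_coeff_eq_val_of_lt _ hi]
    by_cases hj : j < J + 1
    · rw [Polynomial.ofFn_coeff_eq_val_of_lt _ hj]
    · rw [Polynomial.ofFn_coeff_eq_zero_of_ge _ (by omega),
        Polynomial.coeff_eq_zero_of_natDegree_lt]
      exact lt_of_le_of_lt ((hgt_le_iff P J).1 h2 i) (by omega)
  · rw [Polynomial.ofFn_coeff_eq_zero_of_ge _ (by omega),
      Polynomial.coeff_eq_zero_of_natDegree_lt (n := i) (by omega)]

lemma finite_roots {P : Polynomial (Polynomial Fq)} (hP : P ≠ 0) :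
    {α : K Fq | evalK Fq P α = 0}.Finite := by
  have h0 : P.map (emb Fq) ≠ 0 := by
    rwa [Ne, Polynomial.map_eq_zero_iff emb_inj]
  refine ((P.map (emb Fq)).roots.toFinset.finite_toSet).subset ?_
  intro α hα
  simp only [Set.mem_ofPred_eq, evalK_eq] at hα
  simp only [Finset.mem_coe, Multiset.mem_toFinset]
  exact (Polynomial.mem_roots h0).2 hα

lemma upper [Fintype Fq] (n : ℕ) (ξ : K Fq) (hnotalg : ¬ IsAlgDegLe Fq ξ n) (w w' : ℝ)
    (hw0 : 0 ≤ w') (hw : w' < w) (h : w ∈ wnstarSet Fq ξ n) : w' ∈ wnSet Fq ξ n := by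
  obtain ⟨e, he⟩ := exists_e ξ
  obtain ⟨J, hJ⟩ := exists_nat_gt (((n * e : ℕ) : ℝ) / (w - w'))
  rw [div_lt_iff₀ (by linarith)] at hJ
  unfold wnstarSet at h
  unfold wnSet
  simp only [Set.mem_ofPred_eq] at h ⊢
  intro hfin
  apply h
  have hF := (hfin.union (finite_bdd (Fq := Fq) n J))
  have hU := (hF.subset (Set.inter_subset_left (t := {P | P ≠ 0}))).biUnion
    (t := fun P => {α : K Fq | evalK Fq P α = 0}) (fun P hP => finite_roots hP.2)
  refine hU.subset ?_
  rintro α ⟨hα, hdeg, hpos, hlt⟩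
  obtain ⟨p, hp0, hpd, hpα, hHA, -⟩ := exists_HA hα
  simp only [Set.mem_iUnion]
  refine ⟨p, ⟨?_, hp0⟩, hpα⟩
  have hpn : p.natDegree ≤ n := hpd ▸ hdeg
  by_cases hj : hgt p ≤ J
  · exact Or.inr ⟨hpn, hj⟩
  left
  have hpξ : evalK Fq p ξ ≠ 0 := fun h0 => hnotalg ⟨p, hp0, hpn, h0⟩
  refine ⟨hpn, absK_pos.2 hpξ, ?_⟩
  rw [HP_eq, absK_lt_iff hpξ]
  have hx := absK_pos.1 hpos
  set x := ξ - α with hxdef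
  rw [hHA, HP_eq, show -w - 1 = -(w + 1) by ring, absK_lt_iff hx] at hlt
  have hx0 : 0 ≤ x.order := by
    have : (0 : ℝ) < x.order := 
      lt_of_le_of_lt (mul_nonneg (by linarith) (Nat.cast_nonneg _)) hlt
    exact_mod_cast this.le
  have hBx : Bd (-x) x.order := ((bd_iff_order hx).2 le_rfl).neg
  have hexp := eval_add hpn ξ (-x)
  rw [show ξ + -x = α by rw [hxdef]; ring, hpα, Finset.sum_range_succ', tc_zero, pow_zero,
    mul_one] at hexp
  have hB : Bd (evalK Fq p ξ) (x.order - (hgt p + n * e)) := by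
    rw [eq_neg_of_add_eq_zero_right hexp.symm]
    refine (bd_sum _ _ _ fun k _ => ?_).neg
    refine ((tc_bd he hpn le_rfl (k + 1)).mul (hBx.pow (k + 1))).mono ?_
    push_cast
    nlinarith [Int.natCast_nonneg k]
  rw [bd_iff_order hpξ] at hB
  have hB' : (x.order : ℝ) - (hgt p + n * e) ≤ (evalK Fq p ξ).order := by exact_mod_cast hB
  have hjJ : (J : ℝ) ≤ hgt p := by exact_mod_cast (by omega : J ≤ hgt p)
  push_cast at hJ
  nlinarith

lemma lower [Fintype Fq] (n : ℕ) (hn : 1 ≤ n) (ξ : K Fq) (hnotalg : ¬ IsAlgDegLe Fq ξ n)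
    (L : ℕ) (hL : 2 ≤ L) (h : (n : ℝ) + 1 / (2 * (L + 1)) ∉ wnSet Fq ξ n) :
    ((n : ℝ) + 1) * L / (L + 1) - 1 ∈ wnstarSet Fq ξ n := by
  obtain ⟨e, he⟩ := exists_e ξ
  obtain ⟨m, rfl⟩ : ∃ m, n = m + 1 := ⟨n - 1, by omega⟩
  set η : ℝ := 1 / (2 * (L + 1)) with hη
  have hLpos : (0 : ℝ) < L + 1 := by positivity
  have hη1 : η * (2 * (L + 1)) = 1 := by rw [hη]; field_simp
  have hη0 : 0 < η := by rw [hη]; positivity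
  set c : ℕ := (m + 1) * e with hc
  -- finitely many bad polynomials
  obtain ⟨M0, hM0⟩ : ∃ M0 : ℕ, ∀ P : Polynomial (Polynomial Fq), P.natDegree ≤ m + 1 →
      evalK Fq P ξ ≠ 0 → (((m + 1 : ℕ) : ℝ) + η) * hgt P < (evalK Fq P ξ).order →
      ¬ Bd (evalK Fq P ξ) M0 := by
    by_contra hcon
    push Not at hcon
    apply h
    unfold wnSet
    refine inf_of _ (fun P => evalK Fq P ξ) (fun P hP => absK_pos.1 hP.2.1) fun M => ?_
    obtain ⟨P, h1, h2, h3, h4⟩ := hcon M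
    refine ⟨P, ⟨h1, absK_pos.2 h2, ?_⟩, h4⟩
    rw [HP_eq, absK_lt_iff h2]
    exact h3
  unfold wnstarSet
  refine inf_of _ (fun α => ξ - α) (fun α hα => absK_pos.1 hα.2.2.1) fun M => ?_
  set s : ℕ := M + M0 + 4 * c * (m + 2) + c + 1 with hs
  obtain ⟨P, hP0, hPn, hPh, hPB, hPbad⟩ := dichotomy m L s e ξ he
  have hPξ : evalK Fq P ξ ≠ 0 := fun h0 => hnotalg ⟨P, hP0, hPn, h0⟩
  have hcZ : ((m : ℤ) + 1) * e = c := by rw [hc]; push_cast; ring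
  rw [hcZ] at hPB
  set A : ℤ := (m + 1) * L * s + s - c with hA
  have hsM : (M : ℤ) + M0 + 4 * c * (m + 2) + c + 1 = s := by rw [hs]; push_cast; ring
  have hLs0 : (0 : ℤ) ≤ (m + 1) * L * s := by positivity
  have hcm : (0 : ℤ) ≤ 4 * c * (m + 2) := by positivity
  have hAM : (M : ℤ) + M0 + 1 ≤ A := by linarith
  have hgood : ¬ Bd (tc P ξ 1) (-((L : ℤ) * s)) := by
    intro hb
    have hh := hPbad hb
    refine hM0 P hPn hPξ ?_ (hPB.mono (by linarith [Int.natCast_nonneg M]))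
    have hord := (bd_iff_order hPξ).1 hPB
    have hord' : (A : ℝ) ≤ (evalK Fq P ξ).order := by exact_mod_cast hord
    refine lt_of_lt_of_le ?_ hord'
    have hh' : (hgt P : ℝ) ≤ L * s + 2 * c := by exact_mod_cast hh
    have hsR : (M : ℝ) + M0 + 4 * c * (m + 2) + c + 1 = s := by exact_mod_cast hsM
    have hAR : (A : ℝ) = (m + 1) * L * s + s - c := by rw [hA]; push_cast; ring
    have hηs : η * (L * s) ≤ s / 2 := by
      have : η * L ≤ 1 / 2 := by linarith
      have hs0 : (0 : ℝ) ≤ s := by positivity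
      nlinarith
    have hη2 : η ≤ 1 := by
      rw [hη, div_le_one (by positivity)]
      have : (0 : ℝ) ≤ L := by positivity
      linarith
    have hηc : η * c ≤ c := by
      have : (0 : ℝ) ≤ c := by positivity
      nlinarith
    have hm0 : (0 : ℝ) ≤ m := by positivity
    have hc0 : (0 : ℝ) ≤ c := by positivity
    have hmc : (0 : ℝ) ≤ c * m := by positivity
    calc (((m + 1 : ℕ) : ℝ) + η) * hgt P ≤ (((m + 1 : ℕ) : ℝ) + η) * (L * s + 2 * c) :=
          mul_le_mul_of_nonneg_left hh' (by positivity)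
      _ < A := by
        rw [hAR]
        push_cast
        have : (0 : ℝ) ≤ M := by positivity
        have : (0 : ℝ) ≤ M0 := by positivity
        nlinarith
  obtain ⟨δ, hδ, hδ0⟩ := newton hn hPn A (L * s) (((L + 1) * s : ℕ) + c) hPB hgood
    (fun k => by
      refine (tc_bd he hPn hPh k).mono (le_of_eq ?_)
      rw [hc]; push_cast; ring)
    (by linarith [Int.natCast_nonneg M, Int.natCast_nonneg M0]) (by positivity)
    (by
      push_cast
      have : (2 : ℤ) * s ≤ L * s := by
        have : (2 : ℤ) ≤ L := by exact_mod_cast hL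
        nlinarith [Int.natCast_nonneg s]
      linarith [Int.natCast_nonneg M, Int.natCast_nonneg M0])
  have hδne : δ ≠ 0 := by
    intro h0
    rw [h0, add_zero] at hδ0
    exact hPξ hδ0
  have hx : ξ - (ξ + δ) = -δ := by ring
  have hx0 : ξ - (ξ + δ) ≠ 0 := by rw [hx]; exact neg_ne_zero.2 hδne
  have hxB : Bd (ξ - (ξ + δ)) (A + L * s) := by rw [hx]; exact hδ.neg
  have halg : IsAlgK Fq (ξ + δ) := ⟨P, hP0, hδ0⟩
  obtain ⟨p, -, -, -, hHA, hmin⟩ := exists_HA halg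
  refine ⟨ξ + δ, ⟨halg, (degA_le hP0 hδ0).trans hPn, absK_pos.2 hx0, ?_⟩, hxB.mono ?_⟩
  · rw [hHA, HP_eq, show ∀ z : ℝ, -(z - 1) - 1 = -z by intro z; ring, absK_lt_iff hx0]
    have hp : hgt p ≤ (L + 1) * s := (hmin P hP0 hδ0).trans hPh
    have hpR : (hgt p : ℝ) ≤ (L + 1) * s := by exact_mod_cast hp
    have hord := (bd_iff_order hx0).1 hxB
    have hord' : (A : ℝ) + L * s ≤ (ξ - (ξ + δ)).order := by exact_mod_cast hord
    have hAR : (A : ℝ) = (m + 1) * L * s + s - c := by rw [hA]; push_cast; ring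
    have hsc : (c : ℝ) < s := by
      have : (c : ℤ) < s := by linarith [Int.natCast_nonneg M, Int.natCast_nonneg M0]
      exact_mod_cast this
    calc (((m + 1 : ℕ) : ℝ) + 1) * L / (L + 1) * hgt p
        ≤ (((m + 1 : ℕ) : ℝ) + 1) * L / (L + 1) * ((L + 1) * s) :=
          mul_le_mul_of_nonneg_left hpR (by positivity)
      _ = (((m + 1 : ℕ) : ℝ) + 1) * L * s := by field_simp
      _ < A + L * s := by rw [hAR]; push_cast; nlinarith
      _ ≤ _ := hord'
  · have : (0 : ℤ) ≤ L * s := by positivity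
    linarith [Int.natCast_nonneg M, Int.natCast_nonneg M0]

end mainpart

/-- if `ξ` is not algebraic of degree at most `n` and `w_n(ξ) = n`,
then `w_n^*(ξ) = n`. -/
theorem wnstar_eq_n_of_wn_eq_n (Fq : Type) [Field Fq] [Fintype Fq]
    (n : ℕ) (hn : 1 ≤ n) (ξ : K Fq) (hnotalg : ¬ IsAlgDegLe Fq ξ n)
    (h : wn Fq ξ n = (n : EReal)) :
    wnstar Fq ξ n = (n : EReal) := by
  have hnot : ∀ w : ℝ, (n : ℝ) < w → w ∉ wnSet Fq ξ n := by
    intro w hw hmem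
    have h1 : (w : EReal) ≤ wn Fq ξ n := le_sSup ⟨w, hmem, rfl⟩
    rw [h] at h1
    have h2 : (w : EReal) ≤ ((n : ℝ) : EReal) := by exact_mod_cast h1
    exact absurd (EReal.coe_le_coe_iff.1 h2) (not_le.2 hw)
  have hcast : (n : EReal) = ((n : ℝ) : EReal) := by norm_cast
  apply le_antisymm
  · refine sSup_le ?_
    rintro _ ⟨w, hw, rfl⟩
    rw [hcast]
    refine EReal.coe_le_coe_iff.2 ?_
    by_contra hlt
    rw [not_le] at hlt
    have hn0 : (0 : ℝ) ≤ n := by positivity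
    exact hnot ((n + w) / 2) (by linarith)
      (upper n ξ hnotalg w ((n + w) / 2) (by linarith) (by linarith) hw)
  · rw [hcast]
    have hlow : ∀ L : ℕ, 2 ≤ L →
        ((((n : ℝ) + 1) * L / (L + 1) - 1 : ℝ) : EReal) ≤ wnstar Fq ξ n := by
      intro L hL
      refine le_sSup ⟨_, lower n hn ξ hnotalg L hL (hnot _ ?_), rfl⟩
      have : (0 : ℝ) < 1 / (2 * ((L : ℝ) + 1)) := by positivity
      linarith
    have hlim : Filter.Tendsto (fun L : ℕ => ((n : ℝ) + 1) * L / (L + 1) - 1) Filter.atTop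
        (nhds (n : ℝ)) := by
      have h1 := (tendsto_natCast_div_add_atTop (𝕜 := ℝ) (1 : ℝ)).const_mul ((n : ℝ) + 1)
      have h2 := h1.sub_const 1
      simp only [mul_one, add_sub_cancel_right] at h2
      refine h2.congr fun L => ?_
      ring
    refine le_of_tendsto ((continuous_coe_real_ereal.tendsto _).comp hlim) ?_
    filter_upwards [Filter.eventually_ge_atTop 2] with L hL
    exact hlow L hL

end
end MahlerKoksmaFq
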